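/- Let W₀ = V₀ × V₀* carry a generalized almost complex structure J (J skew-adjoint for the pairing, J∘J = −Id) and a self-adjoint G₀ with G₀∘G₀ = Id and G₀∘J = J∘G₀, and let (Φ, E₊, E₋) be a generalized almost contact structure on W₁ = V₁ × V₁* with compatible generalized metric G₁. Define on W₀ × W₁ (with the sum pairing): Φ' := J × Φ, E'₊ := (0, E₊), E'₋ := (0, E₋), G' := G₀ × G₁. Then (Φ', E'₊, E'₋) is a generalized almost contact structure on W₀ × W₁ and G' is a compatible generalized metric for it. -/

import Mathlib

open Module

noncomputable section

/-- The generalized tangent space `W = V × V*`. -/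
abbrev GT (V : Type*) [AddCommGroup V] [Module ℝ V] := V × (V →ₗ[ℝ] ℝ)

/-- The canonical symmetric pairing `⟨(X,α),(Y,β)⟩ = (β X + α Y)/2` on `W = V × V*`. -/
def gpair {V : Type*} [AddCommGroup V] [Module ℝ V] (u v : GT V) : ℝ :=
  (v.2 u.1 + u.2 v.1) / 2

/-- The sum pairing on the product `W₀ × W₁`. -/
def gpairProd {V₀ V₁ : Type*} [AddCommGroup V₀] [Module ℝ V₀] [AddCommGroup V₁]
    [Module ℝ V₁] (p q : GT V₀ × GT V₁) : ℝ :=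
  gpair p.1 q.1 + gpair p.2 q.2

theorem gpairProd_zero_left {V₀ V₁ : Type*} [AddCommGroup V₀] [Module ℝ V₀]
    [AddCommGroup V₁] [Module ℝ V₁] (e : GT V₁) (p : GT V₀ × GT V₁) :
    gpairProd (0, e) p = gpair e p.2 := by
  simp [gpairProd, gpair]

/-- If `W₀` carries a generalized almost complex structure `J` with
commuting compatible metric `G₀`, and `W₁` carries a generalized almost contact metric
structure `(Φ, E₊, E₋, G₁)`, then on `W₀ × W₁` (with the sum pairing) the data
`Φ' = J × Φ`, `E'₊ = (0, E₊)`, `E'₋ = (0, E₋)`, `G' = G₀ × G₁` is a generalized almost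
contact structure with compatible generalized metric `G'`. -/
theorem stmt18 {V₀ V₁ : Type*} [AddCommGroup V₀] [Module ℝ V₀] [FiniteDimensional ℝ V₀]
    [AddCommGroup V₁] [Module ℝ V₁] [FiniteDimensional ℝ V₁]
    (J : GT V₀ →ₗ[ℝ] GT V₀) (G₀ : GT V₀ →ₗ[ℝ] GT V₀)
    (hJskew : ∀ u v : GT V₀, gpair (J u) v = - gpair u (J v))
    (hJsq : ∀ w : GT V₀, J (J w) = -w)
    (hG₀sa : ∀ u v : GT V₀, gpair (G₀ u) v = gpair u (G₀ v))
    (hG₀sq : ∀ w : GT V₀, G₀ (G₀ w) = w)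
    (hG₀J : ∀ w : GT V₀, G₀ (J w) = J (G₀ w))
    (Φ : GT V₁ →ₗ[ℝ] GT V₁) (Ep Em : GT V₁) (G₁ : GT V₁ →ₗ[ℝ] GT V₁)
    (hskew : ∀ u v : GT V₁, gpair (Φ u) v = - gpair u (Φ v))
    (hsq : ∀ w : GT V₁, Φ (Φ w) = -w + (2 * gpair Em w) • Ep + (2 * gpair Ep w) • Em)
    (hpp : gpair Ep Ep = 0) (hmm : gpair Em Em = 0)
    (hpm : 2 * gpair Ep Em = 1)
    (hG₁sa : ∀ u v : GT V₁, gpair (G₁ u) v = gpair u (G₁ v))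
    (hG₁sq : ∀ w : GT V₁, G₁ (G₁ w) = w)
    (hG₁c : ∀ w : GT V₁,
      -(Φ (G₁ (Φ w))) = G₁ w - (2 * gpair Ep w) • Ep - (2 * gpair Em w) • Em) :
    ∀ Φ' G' : GT V₀ × GT V₁ →ₗ[ℝ] GT V₀ × GT V₁,
      Φ' = J.prodMap Φ → G' = G₀.prodMap G₁ →
      ∀ Ep' Em' : GT V₀ × GT V₁, Ep' = (0, Ep) → Em' = (0, Em) →
      ((∀ p q : GT V₀ × GT V₁, gpairProd (Φ' p) q = - gpairProd p (Φ' q)) ∧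
       (∀ p : GT V₀ × GT V₁,
         Φ' (Φ' p) = -p + (2 * gpairProd Em' p) • Ep' + (2 * gpairProd Ep' p) • Em') ∧
       gpairProd Ep' Ep' = 0 ∧ gpairProd Em' Em' = 0 ∧ 2 * gpairProd Ep' Em' = 1) ∧
      ((∀ p q : GT V₀ × GT V₁, gpairProd (G' p) q = gpairProd p (G' q)) ∧
       (∀ p : GT V₀ × GT V₁, G' (G' p) = p) ∧
       (∀ p : GT V₀ × GT V₁,
         -(Φ' (G' (Φ' p))) =
           G' p - (2 * gpairProd Ep' p) • Ep' - (2 * gpairProd Em' p) • Em')) := by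
  rintro Φ' G' rfl rfl Ep' Em' rfl rfl
  refine ⟨⟨?_, ?_, ?_, ?_, ?_⟩, ?_, ?_, ?_⟩
  · intro p q
    simp only [gpairProd, LinearMap.prodMap_apply, hJskew, hskew]
    ring
  · rintro ⟨u, v⟩
    simp only [gpairProd_zero_left, LinearMap.prodMap_apply, hJsq, hsq, Prod.neg_mk,
      Prod.smul_mk, Prod.mk_add_mk, smul_zero, add_zero]
  · rw [gpairProd_zero_left, hpp]
  · rw [gpairProd_zero_left, hmm]
  · rw [gpairProd_zero_left, hpm]
  · intro p q
    simp only [gpairProd, LinearMap.prodMap_apply, hG₀sa, hG₁sa]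
  · intro p
    simp only [LinearMap.prodMap_apply, hG₀sq, hG₁sq]
  · rintro ⟨u, v⟩
    simp only [gpairProd_zero_left, LinearMap.prodMap_apply, hG₀J, hJsq, hG₁c, neg_neg,
      Prod.neg_mk, Prod.smul_mk, Prod.mk_sub_mk, smul_zero, sub_zero]
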